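/- Suppose there exist constants a ∈ (0,1), c > 0 and R > 0 such that (1 − a)|∇V(x)|² − ΔV(x) ≥ c for all |x| ≥ R, and suppose that for every R' > 0 the measure μ satisfies the local Poincaré inequality on B(0,R') with some constant κ_{R'}. Then μ satisfies a Poincaré inequality: there exists C > 0 such that for every smooth compactly supported function f, Var_μ(f) ≤ C ∫ |∇f|² dμ. -/

import Mathlib

open MeasureTheory Real Set
open scoped ENNReal RealInnerProductSpace

noncomputable section

abbrev En (n : ℕ) := EuclideanSpace ℝ (Fin n)

/-- The Laplacian on `ℝⁿ`: sum of second partial derivatives. -/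
def lapl {n : ℕ} (g : En n → ℝ) (x : En n) : ℝ :=
  ∑ i : Fin n,
    fderiv ℝ (fun y => fderiv ℝ g y (EuclideanSpace.single i 1)) x (EuclideanSpace.single i 1)

/-- The diffusion operator `L g = Δ g - ∇V · ∇g`. -/
def Lop {n : ℕ} (V g : En n → ℝ) (x : En n) : ℝ :=
  lapl g x - ⟪gradient V x, gradient g x⟫

/-- The Boltzmann measure `dμ = e^{-V}/Z dx`. -/
def boltz {n : ℕ} (V : En n → ℝ) : Measure (En n) :=
  (volume : Measure (En n)).withDensity
    (fun x => ENNReal.ofReal (Real.exp (-V x) / ∫ y, Real.exp (-V y)))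

lemma norm_gradient_eq_norm_fderiv {n : ℕ} (f : En n → ℝ) (x : En n) :
    ‖gradient f x‖ = ‖fderiv ℝ f x‖ := by
  rw [← toDual_gradient (𝕜 := ℝ) (f := f), LinearIsometryEquiv.norm_map]

lemma norm_gradient_sq_eq_sum {n : ℕ} (f : En n → ℝ) (x : En n) :
    ‖gradient f x‖ ^ 2 = ∑ i : Fin n, (fderiv ℝ f x (EuclideanSpace.single i 1)) ^ 2 := by
  rw [EuclideanSpace.norm_sq_eq]
  refine Finset.sum_congr rfl fun i _ => ?_
  rw [← inner_gradient_left (𝕜 := ℝ) (f := f) (x := x), EuclideanSpace.inner_single_right]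
  simp

lemma continuous_norm_gradient_sq {n : ℕ} {f : En n → ℝ} (hf : ContDiff ℝ 1 f) :
    Continuous fun x => ‖gradient f x‖ ^ 2 := by
  simp only [norm_gradient_eq_norm_fderiv]
  exact (hf.continuous_fderiv one_ne_zero).norm.pow 2

lemma hasCompactSupport_norm_gradient_sq {n : ℕ} {f : En n → ℝ} (hf : HasCompactSupport f) :
    HasCompactSupport fun x => ‖gradient f x‖ ^ 2 := by
  simp only [norm_gradient_eq_norm_fderiv]
  exact (hf.fderiv ℝ).comp_left (g := fun L => ‖L‖ ^ 2) (by simp)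

lemma continuous_lapl {n : ℕ} {V : En n → ℝ} (hV : ContDiff ℝ 2 V) : Continuous (lapl V) := by
  unfold lapl
  have h1 : ContDiff ℝ 1 (fderiv ℝ V) := hV.fderiv_right (by norm_num)
  refine continuous_finsetSum _ fun i _ => ?_
  have h2 : ContDiff ℝ 1 fun y => fderiv ℝ V y (EuclideanSpace.single i (1 : ℝ)) :=
    h1.clm_apply contDiff_const
  exact (h2.continuous_fderiv one_ne_zero).clm_apply continuous_const

/-- Directional form of the Lyapunov inequality with Lyapunov function `e^{aV}`. -/
lemma integral_directional_le {n : ℕ} {V g : En n → ℝ} (hV : ContDiff ℝ 2 V)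
    (hg : ContDiff ℝ 1 g) (hgc : HasCompactSupport g) (a : ℝ) (v : En n) :
    ∫ x, g x ^ 2 * (a * (1 - a) * (fderiv ℝ V x v) ^ 2
        - a * fderiv ℝ (fun y => fderiv ℝ V y v) x v) * Real.exp (-V x)
      ≤ ∫ x, (fderiv ℝ g x v) ^ 2 * Real.exp (-V x) := by
  have hV1 : ContDiff ℝ 1 V := hV.of_le (by norm_num)
  have hDV : ContDiff ℝ 1 fun y => fderiv ℝ V y v :=
    (hV.fderiv_right (m := 1) (by norm_num)).clm_apply contDiff_const
  have cV := hV.continuous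
  have cDV := hDV.continuous
  have cDDV : Continuous fun x => fderiv ℝ (fun y => fderiv ℝ V y v) x v :=
    (hDV.continuous_fderiv one_ne_zero).clm_apply continuous_const
  have cg := hg.continuous
  have cDg : Continuous fun x => fderiv ℝ g x v :=
    (hg.continuous_fderiv one_ne_zero).clm_apply continuous_const
  have integrable_of : ∀ F : En n → ℝ, Continuous F → (∀ x, x ∉ tsupport g → F x = 0) →
      Integrable F := fun F hF h0 =>
    hF.integrable_of_hasCompactSupport (HasCompactSupport.intro hgc h0)
  have g0 : ∀ x, x ∉ tsupport g → g x = 0 := fun x hx => image_eq_zero_of_notMem_tsupport hx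
  have Dg0 : ∀ x, x ∉ tsupport g → fderiv ℝ g x v = 0 := fun x hx => by
    rw [image_eq_zero_of_notMem_tsupport (fun h => hx (tsupport_fderiv_subset ℝ h))]; rfl
  have hD : ∀ x, fderiv ℝ (fun y => g y ^ 2 * Real.exp (-V y)) x v
      = (2 * g x * fderiv ℝ g x v - g x ^ 2 * fderiv ℝ V x v) * Real.exp (-V x) := fun x => by
    have h1 := (hg.differentiable one_ne_zero x).hasFDerivAt
    have h2 := (hV1.differentiable one_ne_zero x).hasFDerivAt
    have h3 : HasFDerivAt (fun y => g y ^ 2 * Real.exp (-V y)) _ x := (h1.pow 2).mul h2.neg.exp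
    rw [h3.fderiv]
    simp
    ring
  have ibp := integral_mul_fderiv_eq_neg_fderiv_mul_of_integrable (μ := (volume : Measure (En n)))
    (f := fun y => g y ^ 2 * Real.exp (-V y)) (g := fun y => fderiv ℝ V y v) (v := v)
    (integrable_of _ (by simp only [hD]; fun_prop)
      (fun x hx => by simp [hD, g0 x hx]))
    (integrable_of _ (by fun_prop) (fun x hx => by simp [g0 x hx]))
    (integrable_of _ (by fun_prop) (fun x hx => by simp [g0 x hx]))
    (fun x _ => ((hg.pow 2).mul hV1.neg.exp).differentiable one_ne_zero x)
    (fun x _ => hDV.differentiable one_ne_zero x)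
  simp only [hD] at ibp
  have i1 : Integrable fun x => g x ^ 2 * (fderiv ℝ V x v) ^ 2 * Real.exp (-V x) :=
    integrable_of _ (by fun_prop) (fun x hx => by simp [g0 x hx])
  have i2 : Integrable fun x => g x ^ 2 * Real.exp (-V x)
      * fderiv ℝ (fun y => fderiv ℝ V y v) x v :=
    integrable_of _ (by fun_prop) (fun x hx => by simp [g0 x hx])
  have i3 : Integrable fun x => (2 * g x * fderiv ℝ g x v - g x ^ 2 * fderiv ℝ V x v)
      * Real.exp (-V x) * fderiv ℝ V x v :=
    integrable_of _ (by fun_prop) (fun x hx => by simp [g0 x hx])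
  have i4 : Integrable fun x => (fderiv ℝ g x v) ^ 2 * Real.exp (-V x) :=
    integrable_of _ (by fun_prop) (fun x hx => by simp [Dg0 x hx])
  calc _ = ∫ x, (a * (1 - a) * (g x ^ 2 * (fderiv ℝ V x v) ^ 2 * Real.exp (-V x))
          - a * (g x ^ 2 * Real.exp (-V x) * fderiv ℝ (fun y => fderiv ℝ V y v) x v)) :=
        integral_congr_ae (.of_forall fun x => by ring)
    _ = ∫ x, (a * (1 - a) * (g x ^ 2 * (fderiv ℝ V x v) ^ 2 * Real.exp (-V x))
          + a * ((2 * g x * fderiv ℝ g x v - g x ^ 2 * fderiv ℝ V x v)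
            * Real.exp (-V x) * fderiv ℝ V x v)) := by
        rw [integral_sub (i1.const_mul _) (i2.const_mul _),
          integral_add (i1.const_mul _) (i3.const_mul _)]
        simp only [integral_const_mul]
        rw [ibp]
        ring
    _ ≤ _ := by
        refine integral_mono ((i1.const_mul _).add (i3.const_mul _)) i4 fun x => ?_
        have := mul_nonneg (sq_nonneg (fderiv ℝ g x v - a * g x * fderiv ℝ V x v))
          (Real.exp_pos (-V x)).le
        simp only
        linarith

lemma integral_lyapunov_le {n : ℕ} {V g : En n → ℝ} (hV : ContDiff ℝ 2 V)
    (hg : ContDiff ℝ 1 g) (hgc : HasCompactSupport g) (a : ℝ) :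
    ∫ x, (a * ((1 - a) * ‖gradient V x‖ ^ 2 - lapl V x)) * g x ^ 2 * Real.exp (-V x)
      ≤ ∫ x, ‖gradient g x‖ ^ 2 * Real.exp (-V x) := by
  have cV := hV.continuous
  have cDV (i : Fin n) : ContDiff ℝ 1 fun y => fderiv ℝ V y (EuclideanSpace.single i (1 : ℝ)) :=
    (hV.fderiv_right (m := 1) (by norm_num)).clm_apply contDiff_const
  have cDDV (i : Fin n) : Continuous fun x => fderiv ℝ (fun y =>
      fderiv ℝ V y (EuclideanSpace.single i (1 : ℝ))) x (EuclideanSpace.single i (1 : ℝ)) :=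
    ((cDV i).continuous_fderiv one_ne_zero).clm_apply continuous_const
  have cDg (i : Fin n) : Continuous fun x => fderiv ℝ g x (EuclideanSpace.single i (1 : ℝ)) :=
    (hg.continuous_fderiv one_ne_zero).clm_apply continuous_const
  have cg := hg.continuous
  simp only [norm_gradient_sq_eq_sum, lapl, Finset.sum_mul, Finset.mul_sum,
    ← Finset.sum_sub_distrib]
  rw [integral_finsetSum, integral_finsetSum]
  · refine Finset.sum_le_sum fun i _ => ?_
    refine le_of_eq_of_le ?_ (integral_directional_le hV hg hgc a (EuclideanSpace.single i 1))
    exact integral_congr_ae (.of_forall fun x => by ring)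
  · intro i _
    refine Continuous.integrable_of_hasCompactSupport (by fun_prop)
      (HasCompactSupport.intro hgc fun x hx => ?_)
    rw [image_eq_zero_of_notMem_tsupport (fun h => hx (tsupport_fderiv_subset ℝ h))]
    simp
  · intro i _
    have := (cDV i).continuous
    have := cDDV i
    refine Continuous.integrable_of_hasCompactSupport (by fun_prop)
      (HasCompactSupport.intro hgc fun x hx => ?_)
    simp [image_eq_zero_of_notMem_tsupport hx]

lemma integral_boltz {n : ℕ} {V : En n → ℝ} (hV : Continuous V) (F : En n → ℝ) :
    ∫ x, F x ∂(boltz V) = (∫ y, Real.exp (-V y))⁻¹ * ∫ x, F x * Real.exp (-V x) := by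
  have hZ : 0 ≤ ∫ y, Real.exp (-V y) := integral_nonneg fun y => (Real.exp_pos _).le
  rw [boltz, integral_withDensity_eq_integral_toReal_smul (by fun_prop) (by simp),
    ← integral_const_mul]
  refine integral_congr_ae (.of_forall fun x => ?_)
  simp only [smul_eq_mul]
  rw [ENNReal.toReal_ofReal (by positivity)]
  ring

lemma isProbabilityMeasure_boltz {n : ℕ} {V : En n → ℝ}
    (hVint : Integrable (fun x => Real.exp (-V x))) : IsProbabilityMeasure (boltz V) := by
  have hZ : 0 < ∫ y, Real.exp (-V y) := integral_exp_pos hVint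
  refine ⟨?_⟩
  rw [boltz, withDensity_apply _ MeasurableSet.univ, Measure.restrict_univ,
    ← ofReal_integral_eq_lintegral_ofReal (hVint.div_const _)
      (.of_forall fun x => div_nonneg (Real.exp_pos _).le hZ.le),
    integral_div, div_self hZ.ne', ENNReal.ofReal_one]

/-- A weighted energy estimate: outside a ball, `∫ g² dμ` is controlled by the Dirichlet form. -/
lemma exists_integral_sq_le_of_drift {n : ℕ} {V : En n → ℝ} (hV : ContDiff ℝ 2 V)
    (hVint : Integrable (fun x => Real.exp (-V x))) {a c R : ℝ} (ha : 0 < a) (hc : 0 < c)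
    (hdrift : ∀ x : En n, R ≤ ‖x‖ → c ≤ (1 - a) * ‖gradient V x‖ ^ 2 - lapl V x) :
    ∃ K : ℝ, 0 ≤ K ∧ ∀ g : En n → ℝ, ContDiff ℝ 1 g → HasCompactSupport g →
      a * c * ∫ x, g x ^ 2 ∂(boltz V) ≤ ∫ x, ‖gradient g x‖ ^ 2 ∂(boltz V)
        + K * ∫ x in {x : En n | ‖x‖ ≤ R}, g x ^ 2 ∂(boltz V) := by
  have := isProbabilityMeasure_boltz hVint
  have hφ : Continuous fun x => a * ((1 - a) * ‖gradient V x‖ ^ 2 - lapl V x) :=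
    continuous_const.mul ((continuous_const.mul (continuous_norm_gradient_sq
      (hV.of_le (by norm_num)))).sub (continuous_lapl hV))
  obtain ⟨b, hb⟩ := (isCompact_closedBall (0 : En n) R).exists_bound_of_continuousOn hφ.continuousOn
  have hB : {x : En n | ‖x‖ ≤ R} = Metric.closedBall 0 R := by ext; simp
  have hBm : MeasurableSet {x : En n | ‖x‖ ≤ R} := hB ▸ measurableSet_closedBall
  refine ⟨|b| + a * c, by positivity, fun g hg hgc => ?_⟩
  have cg := hg.continuous
  have ig : Integrable (fun x => g x ^ 2) (boltz V) :=
    Continuous.integrable_of_hasCompactSupport (by fun_prop)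
      (HasCompactSupport.intro hgc fun x hx => by simp [image_eq_zero_of_notMem_tsupport hx])
  have iφ : Integrable (fun x => (a * ((1 - a) * ‖gradient V x‖ ^ 2 - lapl V x)) * g x ^ 2)
      (boltz V) :=
    Continuous.integrable_of_hasCompactSupport (hφ.mul (by fun_prop))
      (HasCompactSupport.intro hgc fun x hx => by simp [image_eq_zero_of_notMem_tsupport hx])
  have hE : ∫ x, (a * ((1 - a) * ‖gradient V x‖ ^ 2 - lapl V x)) * g x ^ 2 ∂(boltz V)
      ≤ ∫ x, ‖gradient g x‖ ^ 2 ∂(boltz V) := by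
    rw [integral_boltz hV.continuous, integral_boltz hV.continuous]
    exact mul_le_mul_of_nonneg_left (integral_lyapunov_le hV hg hgc a)
      (inv_nonneg.2 (integral_nonneg fun y => (Real.exp_pos _).le))
  have hle : ∫ x, a * c * g x ^ 2 ∂(boltz V)
      ≤ ∫ x, ((a * ((1 - a) * ‖gradient V x‖ ^ 2 - lapl V x)) * g x ^ 2
        + (|b| + a * c) * {x : En n | ‖x‖ ≤ R}.indicator (fun x => g x ^ 2) x) ∂(boltz V) := by
    refine integral_mono (ig.const_mul _) (iφ.add ((ig.indicator hBm).const_mul _)) fun x => ?_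
    simp only
    by_cases hx : ‖x‖ ≤ R
    · rw [Set.indicator_of_mem (show x ∈ {x : En n | ‖x‖ ≤ R} from hx)]
      have h1 := hb x (by simpa using hx)
      have h2 := (abs_le.1 (h1.trans (le_abs_self b))).1
      nlinarith [mul_le_mul_of_nonneg_right h2 (sq_nonneg (g x))]
    · rw [Set.indicator_of_notMem (show x ∉ {x : En n | ‖x‖ ≤ R} from hx)]
      have h1 := mul_le_mul_of_nonneg_left (hdrift x (not_le.1 hx).le) ha.le
      nlinarith [mul_le_mul_of_nonneg_right h1 (sq_nonneg (g x))]
  rw [integral_add iφ ((ig.indicator hBm).const_mul _), integral_const_mul, integral_const_mul,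
    integral_indicator hBm] at hle
  linarith

/-- Smooth cutoffs equal to `1` on large balls with uniformly small gradients. -/
lemma exists_smooth_cutoff (n : ℕ) : ∃ (χ : ℕ → En n → ℝ) (M : ℝ), 0 ≤ M ∧
    ∀ k : ℕ, ContDiff ℝ (⊤ : ℕ∞) (χ k) ∧ HasCompactSupport (χ k) ∧
      (∀ x, |χ k x| ≤ 1) ∧ (∀ x, ‖x‖ ≤ (k + 1 : ℝ) → χ k x = 1) ∧
      ∀ x, ‖gradient (χ k) x‖ ≤ M / (k + 1 : ℝ) := by
  let β : ContDiffBump (0 : En n) := ⟨1, 2, by norm_num, by norm_num⟩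
  have hβ : ContDiff ℝ (⊤ : ℕ∞) β := β.contDiff
  obtain ⟨M, hM⟩ := (β.hasCompactSupport.fderiv ℝ).exists_bound_of_continuous
    (hβ.continuous_fderiv (by simp))
  have hM0 : 0 ≤ M := (norm_nonneg _).trans (hM 0)
  refine ⟨fun k x => β ((k + 1 : ℝ)⁻¹ • x), M, hM0, fun k => ?_⟩
  have hk : (0 : ℝ) < k + 1 := by positivity
  refine ⟨hβ.comp (contDiff_const_smul _), ?_, fun x => ?_, fun x hx => ?_, fun x => ?_⟩
  · exact β.hasCompactSupport.comp_smul (inv_ne_zero hk.ne')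
  · exact abs_le.2 ⟨by linarith [β.nonneg (x := (k + 1 : ℝ)⁻¹ • x)], β.le_one⟩
  · refine β.one_of_mem_closedBall ?_
    simp only [mem_closedBall_zero_iff, norm_smul, norm_inv, Real.norm_eq_abs, abs_of_pos hk]
    exact (inv_mul_le_one₀ hk).2 hx
  · rw [norm_gradient_eq_norm_fderiv, fderiv_comp_smul, norm_smul, norm_inv, Real.norm_eq_abs,
      abs_of_pos hk, div_eq_inv_mul]
    exact mul_le_mul_of_nonneg_left (hM _) (by positivity)

lemma setIntegral_sub_const_sq {α : Type*} [MeasurableSpace α] {μ : Measure α}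
    [IsFiniteMeasure μ] {f : α → ℝ} (hf : Integrable f μ) (hf2 : Integrable (fun x => f x ^ 2) μ)
    (s : Set α) (m : ℝ) :
    ∫ x in s, (f x - m) ^ 2 ∂μ
      = ∫ x in s, f x ^ 2 ∂μ - 2 * m * ∫ x in s, f x ∂μ + m ^ 2 * (μ s).toReal := by
  have h : ∀ x, (f x - m) ^ 2 = f x ^ 2 - 2 * m * f x + m ^ 2 := fun x => by ring
  simp only [h]
  rw [integral_add, integral_sub, integral_const_mul]
  · simp [Measure.real, mul_comm]
  · exact hf2.integrableOn
  · exact (hf.const_mul _).integrableOn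
  · exact (hf2.sub (hf.const_mul _)).integrableOn
  · exact integrable_const _

/-- The estimate of `exists_integral_sq_le_of_drift` extends to functions that are constant at
infinity, at the price of a factor `2`. -/
lemma integral_sub_const_sq_le {n : ℕ} {μ : Measure (En n)} [IsProbabilityMeasure μ]
    {R δ K : ℝ}
    (h : ∀ g : En n → ℝ, ContDiff ℝ 1 g → HasCompactSupport g →
      δ * ∫ x, g x ^ 2 ∂μ ≤ ∫ x, ‖gradient g x‖ ^ 2 ∂μ
        + K * ∫ x in {x : En n | ‖x‖ ≤ R}, g x ^ 2 ∂μ)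
    {f : En n → ℝ} (hf : ContDiff ℝ 1 f) (hfc : HasCompactSupport f) (m : ℝ) :
    δ * ∫ x, (f x - m) ^ 2 ∂μ ≤ 2 * ∫ x, ‖gradient f x‖ ^ 2 ∂μ
        + K * ∫ x in {x : En n | ‖x‖ ≤ R}, (f x - m) ^ 2 ∂μ := by
  obtain ⟨χ, M, hM, hχ⟩ := exists_smooth_cutoff n
  have hB : {x : En n | ‖x‖ ≤ R} = Metric.closedBall 0 R := by ext; simp
  have hBm : MeasurableSet {x : En n | ‖x‖ ≤ R} := hB ▸ measurableSet_closedBall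
  obtain ⟨F, hF⟩ := hfc.exists_bound_of_continuous hf.continuous
  have hχ1 (k : ℕ) : ContDiff ℝ 1 (χ k) := (hχ k).1.of_le (by exact_mod_cast le_top)
  have cont (k : ℕ) : ContDiff ℝ 1 fun x => f x - m * χ k x :=
    hf.sub (contDiff_const.mul (hχ1 k))
  have supp (k : ℕ) : HasCompactSupport fun x => f x - m * χ k x :=
    hfc.sub ((hχ k).2.1.mul_left (f := fun _ => m))
  have lim1 : Filter.Tendsto (fun k : ℕ => δ * ∫ x, (f x - m * χ k x) ^ 2 ∂μ) Filter.atTop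
      (nhds (δ * ∫ x, (f x - m) ^ 2 ∂μ)) := by
    refine Filter.Tendsto.const_mul _ ?_
    refine tendsto_integral_of_dominated_convergence (fun _ => (F + |m|) ^ 2)
      (fun k => ((cont k).continuous.pow 2).aestronglyMeasurable) (integrable_const _)
      (fun k => .of_forall fun x => ?_) (.of_forall fun x => ?_)
    · rw [norm_pow]
      refine pow_le_pow_left₀ (norm_nonneg _) ((norm_sub_le _ _).trans (add_le_add (hF x) ?_)) 2
      rw [norm_mul, Real.norm_eq_abs, Real.norm_eq_abs]
      exact mul_le_of_le_one_right (abs_nonneg m) ((hχ k).2.2.1 x)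
    · refine tendsto_const_nhds.congr' ?_
      filter_upwards [Filter.eventually_ge_atTop ⌈‖x‖⌉₊] with k hk
      rw [(hχ k).2.2.2.1 x (by linarith [Nat.ceil_le.1 hk]), mul_one]
  have lim2 : Filter.Tendsto (fun k : ℕ => 2 * ∫ x, ‖gradient f x‖ ^ 2 ∂μ
      + 2 * (|m| * (M / ((k : ℝ) + 1))) ^ 2
      + K * ∫ x in {x : En n | ‖x‖ ≤ R}, (f x - m) ^ 2 ∂μ) Filter.atTop
      (nhds (2 * ∫ x, ‖gradient f x‖ ^ 2 ∂μ + 2 * (|m| * 0) ^ 2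
        + K * ∫ x in {x : En n | ‖x‖ ≤ R}, (f x - m) ^ 2 ∂μ)) := by
    have h0 : Filter.Tendsto (fun k : ℕ => M / ((k : ℝ) + 1)) Filter.atTop (nhds 0) :=
      tendsto_const_nhds.div_atTop
        (Filter.tendsto_atTop_add_const_right _ _ tendsto_natCast_atTop_atTop)
    exact (((h0.const_mul _).pow 2).const_mul 2 |>.const_add _).add_const _
  have key := le_of_tendsto_of_tendsto lim1 lim2 ?_
  · simpa using key
  filter_upwards [Filter.eventually_ge_atTop ⌈R⌉₊] with k hk
  refine (h _ (cont k) (supp k)).trans (add_le_add ?_ (le_of_eq ?_))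
  · have ifg : Integrable (fun x => ‖gradient f x‖ ^ 2) μ :=
      (continuous_norm_gradient_sq hf).integrable_of_hasCompactSupport
        (hasCompactSupport_norm_gradient_sq hfc)
    have hc : 2 * ∫ x, ‖gradient f x‖ ^ 2 ∂μ + 2 * (|m| * (M / ((k : ℝ) + 1))) ^ 2
        = ∫ x, (2 * ‖gradient f x‖ ^ 2 + 2 * (|m| * (M / ((k : ℝ) + 1))) ^ 2) ∂μ := by
      rw [integral_add (ifg.const_mul _) (integrable_const _), integral_const_mul]
      simp
    rw [hc]
    refine integral_mono ((continuous_norm_gradient_sq (cont k)).integrable_of_hasCompactSupport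
        (hasCompactSupport_norm_gradient_sq (supp k)))
      ((ifg.const_mul _).add (integrable_const _)) fun x => ?_
    have hgrad : ‖gradient (fun x => f x - m * χ k x) x‖
        ≤ ‖gradient f x‖ + |m| * (M / ((k : ℝ) + 1)) := by
      have hd : HasFDerivAt (fun x => f x - m * χ k x) _ x :=
        (hf.differentiable one_ne_zero x).hasFDerivAt.sub
          (((hχ1 k).differentiable one_ne_zero x).hasFDerivAt.const_mul m)
      have hx := (hχ k).2.2.2.2 x
      rw [norm_gradient_eq_norm_fderiv] at hx
      rw [norm_gradient_eq_norm_fderiv, norm_gradient_eq_norm_fderiv]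
      rw [hd.fderiv]
      refine (norm_sub_le _ _).trans ?_
      rw [norm_smul, Real.norm_eq_abs]
      gcongr
    simp only
    have h2 := pow_le_pow_left₀ (norm_nonneg _) hgrad 2
    nlinarith [sq_nonneg (‖gradient f x‖ - |m| * (M / ((k : ℝ) + 1)))]
  · congr 1
    refine setIntegral_congr_fun hBm fun x hx => ?_
    have hx' : ‖x‖ ≤ R := hx
    rw [(hχ k).2.2.2.1 x (by linarith [Nat.ceil_le.1 hk]), mul_one]

/-- if `(1-a)|∇V|² - ΔV ≥ c > 0` outside a ball (for some `a ∈ (0,1)`) and local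
Poincaré inequalities hold on all balls, then `μ` satisfies a Poincaré inequality. -/
theorem stmt3 {n : ℕ} (hn : 0 < n) (V : En n → ℝ) (hV : ContDiff ℝ 2 V)
    (hVint : Integrable (fun x => Real.exp (-V x)))
    (a c R : ℝ) (ha : 0 < a) (ha1 : a < 1) (hc : 0 < c) (hR : 0 < R)
    (hdrift : ∀ x : En n, R ≤ ‖x‖ → c ≤ (1 - a) * ‖gradient V x‖ ^ 2 - lapl V x)
    (hloc : ∀ R' : ℝ, 0 < R' → ∃ κ : ℝ,
      ∀ f : En n → ℝ, ContDiff ℝ (⊤ : ℕ∞) f → HasCompactSupport f →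
        ∫ x in {x : En n | ‖x‖ ≤ R'}, (f x) ^ 2 ∂(boltz V)
          ≤ κ * ∫ x, ‖gradient f x‖ ^ 2 ∂(boltz V)
            + ((boltz V) {x : En n | ‖x‖ ≤ R'}).toReal⁻¹
                * (∫ x in {x : En n | ‖x‖ ≤ R'}, f x ∂(boltz V)) ^ 2) :
    ∃ C : ℝ, 0 < C ∧ ∀ f : En n → ℝ, ContDiff ℝ (⊤ : ℕ∞) f → HasCompactSupport f →
      ∫ x, (f x) ^ 2 ∂(boltz V) - (∫ x, f x ∂(boltz V)) ^ 2
        ≤ C * ∫ x, ‖gradient f x‖ ^ 2 ∂(boltz V) := by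
  have := isProbabilityMeasure_boltz hVint
  obtain ⟨K, hK, hKle⟩ := exists_integral_sq_le_of_drift hV hVint ha hc hdrift
  obtain ⟨κ, hκ⟩ := hloc R hR
  have hac : 0 < a * c := mul_pos ha hc
  refine ⟨(2 + K * |κ|) / (a * c), by positivity, fun f hf hfc => ?_⟩
  have hf1 : ContDiff ℝ 1 f := hf.of_le (by exact_mod_cast le_top)
  have i1 : Integrable f (boltz V) := hf.continuous.integrable_of_hasCompactSupport hfc
  have i2 : Integrable (fun x => f x ^ 2) (boltz V) :=
    (hf.continuous.pow 2).integrable_of_hasCompactSupport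
      (HasCompactSupport.intro hfc fun x hx => by simp [image_eq_zero_of_notMem_tsupport hx])
  set B : Set (En n) := {x | ‖x‖ ≤ R}
  set m : ℝ := ((boltz V) B).toReal⁻¹ * ∫ x in B, f x ∂(boltz V) with hm
  have hG : 0 ≤ ∫ x, ‖gradient f x‖ ^ 2 ∂(boltz V) := integral_nonneg fun x => sq_nonneg _
  have hball : ∫ x in B, (f x - m) ^ 2 ∂(boltz V)
      ≤ |κ| * ∫ x, ‖gradient f x‖ ^ 2 ∂(boltz V) := by
    have h1 := hκ f hf hfc
    have h2 := mul_le_mul_of_nonneg_right (le_abs_self κ) hG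
    have h3 : - 2 * m * ∫ x in B, f x ∂(boltz V) + m ^ 2 * ((boltz V) B).toReal
        = - (((boltz V) B).toReal⁻¹ * (∫ x in B, f x ∂(boltz V)) ^ 2) := by
      rw [hm]
      rcases eq_or_ne ((boltz V) B).toReal 0 with h | h
      · simp [h]
      · field_simp
        ring
    rw [setIntegral_sub_const_sq i1 i2]
    linarith
  have hvar : ∫ x, (f x) ^ 2 ∂(boltz V) - (∫ x, f x ∂(boltz V)) ^ 2
      ≤ ∫ x, (f x - m) ^ 2 ∂(boltz V) := by
    have h := setIntegral_sub_const_sq i1 i2 univ m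
    simp only [Measure.restrict_univ, measure_univ, ENNReal.toReal_one] at h
    rw [h]
    nlinarith [sq_nonneg (∫ x, f x ∂(boltz V) - m)]
  have hmain := integral_sub_const_sq_le hKle hf1 hfc m
  have h4 := mul_le_mul_of_nonneg_left hball hK
  refine hvar.trans ?_
  rw [div_mul_eq_mul_div, le_div_iff₀ hac]
  linarith
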